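/- arXiv:2410.07829 — 2 statements merged into one kernel-verified Lean document; each statement's English description precedes it below -/
import Mathlib

section
/- Let f : ℝ → ℝ be defined by f(x) = 0 if x ≤ −3; f(x) = x + 3 if −3 < x ≤ −2; f(x) = −x − 1 if −2 < x < −1; and f(x) = 0 if x ≥ −1. For every positive natural number b, consider the family H_b of binary graph classifiers indexed by γ ∈ {0, 1, ..., 2^b − 1}, where the classifier with parameter γ assigns the label 'positive' to a finite simple graph G if and only if Σ_{v ∈ V(G)} f(γ − deg_G(v)) ≥ 1. Then H_b shatters some set of b finite simple graphs, and H_b shatters no set of b + 1 finite simple graphs. -/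
/-- The piecewise linear activation function:
f(x) = 0 if x ≤ −3; f(x) = x + 3 if −3 < x ≤ −2; f(x) = −x − 1 if −2 < x < −1;
f(x) = 0 if x ≥ −1. -/
noncomputable def pwlActivation (x : ℝ) : ℝ :=
  if x ≤ -3 then 0
  else if x ≤ -2 then x + 3
  else if x < -1 then -x - 1
  else 0

theorem pwlActivation_natCast_sub_natCast (m d : ℕ) :
    pwlActivation ((m : ℝ) - d) = if d = m + 2 then 1 else 0 := by
  unfold pwlActivation
  rcases lt_trichotomy d (m + 2) with h | rfl | h
  · have h' : (d : ℝ) ≤ m + 1 := by exact_mod_cast Nat.le_of_lt_succ h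
    simp only [h.ne, if_false]
    rw [if_neg (by linarith), if_neg (by linarith), if_neg (by linarith)]
  · simp only [if_true]
    push_cast
    rw [if_neg (by linarith), if_pos (by linarith)]
    ring
  · have h' : (m : ℝ) + 3 ≤ d := by exact_mod_cast h
    rw [if_pos (by linarith), if_neg (by lia)]

/-- At a natural number parameter the classifier tests for a vertex of a prescribed degree. -/
theorem one_le_sum_pwlActivation_iff {V : Type*} [Fintype V] (deg : V → ℕ) (m : ℕ) :
    1 ≤ ∑ v, pwlActivation ((m : ℝ) - deg v) ↔ ∃ v, deg v = m + 2 := by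
  simp only [pwlActivation_natCast_sub_natCast, Finset.sum_boole, Nat.one_le_cast,
    Nat.one_le_iff_ne_zero, Finset.card_ne_zero, Finset.Nonempty, Finset.mem_filter,
    Finset.mem_univ, true_and]

/-- Every finite set of naturals is the degree set of a finite simple graph
(a disjoint union of complete graphs). -/
theorem SimpleGraph.exists_degree_set_eq (A : Finset ℕ) :
    ∃ (n : ℕ) (G : SimpleGraph (Fin n)), ∀ d, (∃ v, (G.neighborSet v).ncard = d) ↔ d ∈ A := by
  let H : SimpleGraph (Σ a : A, Fin (a + 1)) :=
    { Adj x y := x ≠ y ∧ x.1 = y.1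
      symm := ⟨fun _ _ h => ⟨h.1.symm, h.2.symm⟩⟩
      loopless := ⟨fun _ h => h.1 rfl⟩ }
  have hH (a : A) (i : Fin (a + 1)) : (H.neighborSet ⟨a, i⟩).ncard = a := by
    have : H.neighborSet ⟨a, i⟩ = Sigma.mk a '' ({i}ᶜ : Set (Fin (a + 1))) := by
      ext ⟨c, j⟩
      constructor
      · rintro ⟨hne, rfl : a = c⟩
        exact ⟨j, fun h => hne (by rw [Set.mem_singleton_iff.mp h]), rfl⟩
      · rintro ⟨k, hk, h⟩
        rw [← h]
        exact ⟨fun h => hk (sigma_mk_injective h).symm, rfl⟩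
    rw [this, Set.ncard_image_of_injective _ sigma_mk_injective, Set.ncard_compl]
    simp
  let e := (Fintype.equivFin (Σ a : A, Fin (a + 1))).symm
  refine ⟨_, H.comap e, fun d => ?_⟩
  have he (v) : ((H.comap e).neighborSet v).ncard = (e v).1 := by
    rw [← hH (e v).1 (e v).2]
    exact Set.ncard_preimage_of_injective_subset_range (s := H.neighborSet (e v))
      e.injective (by simp)
  simp only [he]
  constructor
  · rintro ⟨v, rfl⟩
    exact (e v).1.2
  · intro hd
    exact ⟨e.symm ⟨⟨d, hd⟩, 0⟩, by simp⟩

/-- A family of at most `2 ^ b` classifiers does not shatter `b + 1` points. -/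
theorem not_shatters_of_lt_two_pow (b : ℕ) (P : ℕ → Fin (b + 1) → Prop) :
    ¬ ∀ S : Set (Fin (b + 1)), ∃ m : ℕ, m < 2 ^ b ∧ ∀ j, P m j ↔ j ∈ S := by
  intro h
  choose g hg hP using h
  have hinj : Function.Injective fun S => (⟨g S, hg S⟩ : Fin (2 ^ b)) := by
    intro S T hST
    ext j
    rw [← hP S j, ← hP T j, Fin.mk.inj hST]
  have := Fintype.card_le_of_injective _ hinj
  simp only [Fintype.card_set, Fintype.card_fin, pow_succ] at this
  have := Nat.two_pow_pos b
  omega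

/-- The family H_b of classifiers indexed by γ ∈ {0,…,2^b − 1},
where the classifier with parameter γ labels a finite simple graph G positive
iff Σ_{v ∈ V(G)} f(γ − deg_G(v)) ≥ 1, shatters some set of b finite simple
graphs, and shatters no set of b + 1 finite simple graphs. -/
theorem vc_dim_pwl_family (b : ℕ) (hb : 0 < b) :
    (∃ (n : Fin b → ℕ) (G : ∀ j, SimpleGraph (Fin (n j))),
      ∀ S : Set (Fin b), ∃ γ : ℕ, γ < 2 ^ b ∧
        ∀ j, (1 ≤ ∑ v, pwlActivation ((γ : ℝ) - ((G j).neighborSet v).ncard))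
          ↔ j ∈ S) ∧
    ∀ (n : Fin (b + 1) → ℕ) (G : ∀ j, SimpleGraph (Fin (n j))),
      ¬ ∀ S : Set (Fin (b + 1)), ∃ γ : ℕ, γ < 2 ^ b ∧
        ∀ j, (1 ≤ ∑ v, pwlActivation ((γ : ℝ) - ((G j).neighborSet v).ncard))
          ↔ j ∈ S := by
  refine ⟨?_, fun n G => not_shatters_of_lt_two_pow b _⟩
  let e : Set (Fin b) ≃ Fin (2 ^ b) := Fintype.equivFinOfCardEq (by simp)
  classical
  choose n G hG using fun j : Fin b => SimpleGraph.exists_degree_set_eq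
    ((Finset.univ.filter fun m : Fin (2 ^ b) => j ∈ e.symm m).image fun m => (m : ℕ) + 2)
  refine ⟨n, G, fun S => ⟨e S, (e S).2, fun j => ?_⟩⟩
  rw [one_le_sum_pwlActivation_iff (fun v => ((G j).neighborSet v).ncard), hG]
  simp [Fin.val_inj]
end

section
/- For every positive natural number b, consider the family F_b of binary graph classifiers indexed by bit strings x ∈ {0,1}^b, where the classifier indexed by x assigns the label 'positive' to a finite simple graph G if and only if Σ_{v ∈ V(G)} sin((π/2)·(1 + deg_G(v))·γ_x) ≥ 2/3, with γ_x = Σ_{k=1}^{b} x_k / 4^k. Then F_b shatters some set of b finite simple graphs, and F_b shatters no set of b + 1 finite simple graphs. -/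
/-- A complete multipartite graph with `p` parts of size three and `q` parts of size two,
together with an extra vertex joined exactly to the parts of size three. -/
def pointedMultipartite (p q : ℕ) : SimpleGraph (Option (Fin p × Fin 3 ⊕ Fin q × Fin 2)) where
  Adj
    | none, some (.inl _) => True
    | some (.inl _), none => True
    | some (.inl u), some (.inl v) => u.1 ≠ v.1
    | some (.inr u), some (.inr v) => u.1 ≠ v.1
    | some (.inl _), some (.inr _) => True
    | some (.inr _), some (.inl _) => True
    | _, _ => False
  symm := ⟨by rintro (_ | _ | _) (_ | _ | _) <;> simp [eq_comm]⟩
  loopless := ⟨by rintro (_ | _ | _) <;> simp⟩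

theorem ncard_setOf_eq_sum {V : Type*} [Fintype V] (P : V → Prop) [DecidablePred P] :
    {v | P v}.ncard = ∑ v, if P v then 1 else 0 := by
  rw [Set.ncard_eq_toFinset_card', Finset.sum_boole]
  simp

theorem ncard_ne_prod {p c : ℕ} (i : Fin p) :
    ∑ u : Fin p × Fin c, (if i ≠ u.1 then 1 else 0) = c * p - c := by
  rw [Fintype.sum_prod_type]
  have (x : Fin p) : ∑ _y : Fin c, (if i ≠ x then 1 else 0) = c * if i ≠ x then 1 else 0 := by
    simp
  simp only [this, ← Finset.mul_sum, Finset.sum_boole, Finset.filter_ne]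
  simp [Nat.mul_sub]

open Classical in
theorem pointedMultipartite_ncard_none (p q : ℕ) :
    ((pointedMultipartite p q).neighborSet none).ncard = 3 * p := by
  rw [SimpleGraph.neighborSet, ncard_setOf_eq_sum, Fintype.sum_option, Fintype.sum_sum_type]
  simp [pointedMultipartite, mul_comm]

open Classical in
theorem pointedMultipartite_ncard_some (p q : ℕ) (v : Fin p × Fin 3 ⊕ Fin q × Fin 2) :
    ((pointedMultipartite p q).neighborSet (some v)).ncard = 3 * p + 2 * q - 2 := by
  rw [SimpleGraph.neighborSet, ncard_setOf_eq_sum, Fintype.sum_option, Fintype.sum_sum_type]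
  rcases v with ⟨i, c⟩ | ⟨i, c⟩
  · have h : ∑ u, (if (pointedMultipartite p q).Adj (some (.inl (i, c))) (some (.inl u))
        then 1 else 0) = 3 * p - 3 :=
      (Finset.sum_congr rfl fun u _ => by
        by_cases hu : i = u.1 <;> simp [pointedMultipartite, hu]).trans (ncard_ne_prod i)
    have := i.pos
    rw [h]
    simp [pointedMultipartite]
    omega
  · have h : ∑ u, (if (pointedMultipartite p q).Adj (some (.inr (i, c))) (some (.inr u))
        then 1 else 0) = 2 * q - 2 :=
      (Finset.sum_congr rfl fun u _ => by
        by_cases hu : i = u.1 <;> simp [pointedMultipartite, hu]).trans (ncard_ne_prod i)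
    have := i.pos
    rw [h]
    simp [pointedMultipartite]
    omega

/-- Every graph on a finite type has a copy on some `Fin n` with the same degree statistics. -/
theorem exists_fin_graph_sum_ncard {V : Type*} [Fintype V] (G : SimpleGraph V) :
    ∃ (n : ℕ) (H : SimpleGraph (Fin n)), ∀ F : ℕ → ℝ,
      ∑ v, F (H.neighborSet v).ncard = ∑ v, F (G.neighborSet v).ncard := by
  refine ⟨Fintype.card V, G.comap (Fintype.equivFin V).symm, fun F => ?_⟩
  refine Fintype.sum_equiv (Fintype.equivFin V).symm _ _ fun v => ?_
  congr 1
  have h : (G.comap (Fintype.equivFin V).symm).neighborSet v =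
      (Fintype.equivFin V).symm ⁻¹' G.neighborSet ((Fintype.equivFin V).symm v) := rfl
  rw [h, Set.ncard_preimage_of_injective_subset_range (Fintype.equivFin V).symm.injective]
  simp

/-- There is a graph with one vertex of degree `4 ^ j - 1` all of whose other vertices have
degree `4 ^ (b + 1) - 1`. -/
theorem exists_graph_one_exceptional_degree {j b : ℕ} (hj : 0 < j) (hjb : j ≤ b) :
    ∃ (n : ℕ) (G : SimpleGraph (Fin n)), ∀ F : ℕ → ℝ, F (4 ^ (b + 1) - 1) = 0 →
      ∑ v, F (G.neighborSet v).ncard = F (4 ^ j - 1) := by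
  obtain ⟨p, hp⟩ : 3 ∣ 4 ^ j - 1 := by simpa using Nat.sub_dvd_pow_sub_pow 4 1 j
  obtain ⟨r, hr⟩ : 2 ∣ 4 ^ j := dvd_pow (by norm_num) hj.ne'
  have hpos : 0 < 4 ^ j := by positivity
  have hle : 4 ^ j ≤ 4 ^ b := Nat.pow_le_pow_right (by norm_num) hjb
  have hq : 3 * p + 2 * (2 * 4 ^ b + 1 - r) - 2 = 4 ^ (b + 1) - 1 := by
    rw [pow_succ]; omega
  obtain ⟨n, G, hG⟩ := exists_fin_graph_sum_ncard (pointedMultipartite p (2 * 4 ^ b + 1 - r))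
  refine ⟨n, G, fun F hF => ?_⟩
  rw [hG, Fintype.sum_option, pointedMultipartite_ncard_none, ← hp]
  simp [pointedMultipartite_ncard_some, hq, hF]

theorem exists_nat_pow_mul_sum_div_pow (y : ℕ → ℕ) (b : ℕ) :
    ∃ A : ℕ, 4 ^ b * ∑ k ∈ Finset.range b, (y k : ℝ) / 4 ^ (k + 1) = A := by
  induction b with
  | zero => exact ⟨0, by simp⟩
  | succ b ih =>
    obtain ⟨A, hA⟩ := ih
    refine ⟨4 * A + y b, ?_⟩
    push_cast
    rw [Finset.sum_range_succ, ← hA, mul_add, pow_succ]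
    field_simp

theorem sum_div_four_pow_le (y : ℕ → ℕ) (hy : ∀ k, y k ≤ 1) (t : ℕ) :
    ∑ k ∈ Finset.range t, (y k : ℝ) / 4 ^ (k + 1) ≤ (1 - 1 / 4 ^ t) / 3 := by
  induction t with
  | zero => simp
  | succ t ih =>
    rw [Finset.sum_range_succ]
    have h : (y t : ℝ) / 4 ^ (t + 1) ≤ 1 / 4 ^ (t + 1) := by
      gcongr
      exact_mod_cast hy t
    have h4 : (1 : ℝ) / 4 ^ t = 4 * (1 / 4 ^ (t + 1)) := by
      field_simp
      ring
    linarith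

/-- Multiplying by `4 ^ (j + 1)` moves the digit at position `j` of a base-four expansion with
digits at most one to the units place. -/
theorem exists_pow_mul_sum_eq_digit (y : ℕ → ℕ) (hy : ∀ k, y k ≤ 1) {j b : ℕ} (hj : j < b) :
    ∃ (A : ℕ) (f : ℝ), 0 ≤ f ∧ f ≤ 1 / 3 ∧
      4 ^ (j + 1) * ∑ k ∈ Finset.range b, (y k : ℝ) / 4 ^ (k + 1) = 4 * A + y j + f := by
  obtain ⟨t, rfl⟩ := Nat.exists_eq_add_of_lt hj
  obtain ⟨A, hA⟩ := exists_nat_pow_mul_sum_div_pow y j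
  refine ⟨A, ∑ k ∈ Finset.range t, (y (j + 1 + k) : ℝ) / 4 ^ (k + 1), by positivity, ?_, ?_⟩
  · have h := sum_div_four_pow_le (fun k => y (j + 1 + k)) (fun k => hy _) t
    have : (0 : ℝ) < 1 / 4 ^ t := by positivity
    linarith
  · rw [show j + t + 1 = j + 1 + t by ring, Finset.sum_range_add, Finset.sum_range_succ, mul_add,
      mul_add, ← hA]
    congr 1
    · rw [pow_succ]
      field_simp
    · rw [Finset.mul_sum]
      refine Finset.sum_congr rfl fun k _ => ?_
      rw [show j + 1 + k + 1 = (j + 1) + (k + 1) by ring, pow_add _ (j + 1)]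
      field_simp

theorem two_thirds_le_sin_iff {A d : ℕ} {f : ℝ} (hd : d = 0 ∨ d = 1) (hf0 : 0 ≤ f)
    (hf : f ≤ 1 / 3) : 2 / 3 ≤ Real.sin (Real.pi / 2 * (4 * A + d + f)) ↔ d = 1 := by
  have hpi := Real.pi_pos
  have hmul : Real.pi / 2 * f ≤ Real.pi / 6 := by nlinarith
  have hmul0 : 0 ≤ Real.pi / 2 * f := by positivity
  rw [show Real.pi / 2 * (4 * A + d + f) = Real.pi / 2 * (d + f) + A * (2 * Real.pi) by ring,
    Real.sin_add_nat_mul_two_pi]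
  rcases hd with rfl | rfl
  · have h := Real.sin_le_sin_of_le_of_le_pi_div_two (by linarith) (by linarith) hmul
    rw [Real.sin_pi_div_six] at h
    simp only [Nat.cast_zero, zero_add, zero_ne_one, iff_false, not_le]
    linarith
  · have h := Real.cos_le_cos_of_nonneg_of_le_pi hmul0 (by linarith) hmul
    rw [Real.cos_pi_div_six] at h
    have h3 : (4 / 3 : ℝ) ≤ √3 := Real.le_sqrt_of_sq_le (by norm_num)
    rw [show Real.pi / 2 * (((1 : ℕ) : ℝ) + f) = Real.pi / 2 * f + Real.pi / 2 by push_cast; ring,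
      Real.sin_add_pi_div_two]
    simp only [iff_true]
    linarith

theorem two_thirds_le_sin_pow_mul_iff {b : ℕ} (x : Fin b → ℕ) (hx : ∀ k, x k = 0 ∨ x k = 1)
    (j : Fin b) :
    2 / 3 ≤ Real.sin (Real.pi / 2 * 4 ^ ((j : ℕ) + 1) *
      ∑ k : Fin b, (x k : ℝ) / 4 ^ ((k : ℕ) + 1)) ↔ x j = 1 := by
  let y : ℕ → ℕ := fun k => if h : k < b then x ⟨k, h⟩ else 0
  have hyx (k : Fin b) : y k = x k := by simp [y]
  have hy (k : ℕ) : y k ≤ 1 := by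
    by_cases h : k < b
    · have := hx ⟨k, h⟩
      simp only [y, h, ↓reduceDIte]
      omega
    · simp [y, h]
  obtain ⟨A, f, hf0, hf, h⟩ := exists_pow_mul_sum_eq_digit y hy j.isLt
  rw [← Fin.sum_univ_eq_sum_range (fun k => (y k : ℝ) / 4 ^ (k + 1))] at h
  simp only [hyx] at h
  rw [mul_assoc, h]
  exact two_thirds_le_sin_iff (hx j) hf0 hf

theorem sin_four_pow_mul_sum_eq_zero {b : ℕ} (x : Fin b → ℕ) :
    Real.sin (Real.pi / 2 * 4 ^ (b + 1) *
      ∑ k : Fin b, (x k : ℝ) / 4 ^ ((k : ℕ) + 1)) = 0 := by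
  obtain ⟨A, hA⟩ := exists_nat_pow_mul_sum_div_pow (fun k => if h : k < b then x ⟨k, h⟩ else 0) b
  rw [← Fin.sum_univ_eq_sum_range
    (fun k => ((if h : k < b then x ⟨k, h⟩ else 0 : ℕ) : ℝ) / 4 ^ (k + 1))] at hA
  simp only [Fin.is_lt, ↓reduceDIte, Fin.eta] at hA
  rw [pow_succ, show ∀ s : ℝ, Real.pi / 2 * (4 ^ b * 4) * s = 2 * (4 ^ b * s) * Real.pi by
    intro s; ring, hA]
  exact_mod_cast Real.sin_nat_mul_pi (2 * A)

/-- A family of predicates indexed by `{0, 1}`-strings of length `b` shatters no `b + 1` points. -/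
theorem not_shatters_of_bitstrings {b : ℕ} (P : (Fin b → ℕ) → Fin (b + 1) → Prop) :
    ¬ ∀ S : Set (Fin (b + 1)), ∃ x : Fin b → ℕ, (∀ k, x k = 0 ∨ x k = 1) ∧
      ∀ j, P x j ↔ j ∈ S := by
  intro h
  choose x hx hP using h
  have hinj : Function.Injective fun S => {k | x S k = 1} := by
    intro S T hST
    have hxST : x S = x T := by
      funext k
      have hk : x S k = 1 ↔ x T k = 1 := Set.ext_iff.mp hST k
      have := hx S k
      have := hx T k
      omega
    ext j
    rw [← hP S j, ← hP T j, hxST]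
  have hcard := Fintype.card_le_of_injective _ hinj
  rw [Fintype.card_set, Fintype.card_set, Fintype.card_fin, Fintype.card_fin, pow_succ] at hcard
  have : 0 < 2 ^ b := by positivity
  omega


/-- The family F_b of classifiers indexed by bit strings
x ∈ {0,1}^b, where the classifier indexed by x labels a finite simple graph G
positive iff Σ_{v ∈ V(G)} sin((π/2)·(1 + deg_G(v))·γ_x) ≥ 2/3 with
γ_x = Σ_{k=1}^b x_k / 4^k, shatters some set of b finite simple graphs, and
shatters no set of b + 1 finite simple graphs. -/
theorem vc_dim_sin_family (b : ℕ) (hb : 0 < b) :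
    (∃ (n : Fin b → ℕ) (G : ∀ j, SimpleGraph (Fin (n j))),
      ∀ S : Set (Fin b), ∃ x : Fin b → ℕ, (∀ k, x k = 0 ∨ x k = 1) ∧
        ∀ j, (2 / 3 ≤ ∑ v, Real.sin (Real.pi / 2
              * (1 + (((G j).neighborSet v).ncard : ℝ))
              * (∑ k : Fin b, (x k : ℝ) / 4 ^ ((k : ℕ) + 1))))
          ↔ j ∈ S) ∧
    ∀ (n : Fin (b + 1) → ℕ) (G : ∀ j, SimpleGraph (Fin (n j))),
      ¬ ∀ S : Set (Fin (b + 1)), ∃ x : Fin b → ℕ, (∀ k, x k = 0 ∨ x k = 1) ∧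
        ∀ j, (2 / 3 ≤ ∑ v, Real.sin (Real.pi / 2
              * (1 + (((G j).neighborSet v).ncard : ℝ))
              * (∑ k : Fin b, (x k : ℝ) / 4 ^ ((k : ℕ) + 1))))
          ↔ j ∈ S := by
  classical
  refine ⟨?_, fun n G => not_shatters_of_bitstrings _⟩
  choose n G hG using fun j : Fin b =>
    exists_graph_one_exceptional_degree (j := j + 1) (b := b) (Nat.succ_pos _) j.isLt
  refine ⟨n, G, fun S => ⟨fun k => if k ∈ S then 1 else 0, fun k => ?_, fun j => ?_⟩⟩
  · by_cases h : k ∈ S <;> simp [h]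
  set x : Fin b → ℕ := fun k => if k ∈ S then 1 else 0 with hx
  have hcast (m : ℕ) : (1 : ℝ) + ((4 ^ m - 1 : ℕ) : ℝ) = 4 ^ m := by
    rw [Nat.cast_sub (Nat.one_le_pow _ _ (by norm_num))]
    push_cast
    ring
  rw [hG j (fun d => Real.sin (Real.pi / 2 * (1 + (d : ℝ)) *
      (∑ k : Fin b, (x k : ℝ) / 4 ^ ((k : ℕ) + 1)))) (by
        simp only [hcast]
        exact sin_four_pow_mul_sum_eq_zero x), hcast,
    two_thirds_le_sin_pow_mul_iff x (fun k => by by_cases h : k ∈ S <;> simp [hx, h])]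
  simp [hx]
end
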